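/- arXiv:2110.09190 — 2 statements merged into one kernel-verified Lean document; each statement's English description precedes it below -/
import Mathlib

section
/- For the path graph P_{11}, γ_s(P_{11}^{1/2}) = 9, which is strictly less than min{|E(P_{11})|, |V(P_{11})|} = 10. -/
open SimpleGraph

/-- `D` is a dominating set of the simple graph `H`. -/
def Dominates {W : Type*} (H : SimpleGraph W) (D : Set W) : Prop :=
  ∀ v ∉ D, ∃ u ∈ D, H.Adj u v

/-- `D` is a secure dominating set of `H`: it is dominating, and every vertex outside `D`
has a neighbour `v ∈ D` whose swap keeps the set dominating. -/
def SecureDominates {W : Type*} (H : SimpleGraph W) (D : Set W) : Prop :=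
  Dominates H D ∧ ∀ u ∉ D, ∃ v ∈ D, H.Adj u v ∧ Dominates H ((D \ {v}) ∪ {u})

/-- The domination number `γ(H)`. -/
noncomputable def domNum {W : Type*} (H : SimpleGraph W) : ℕ :=
  sInf {n | ∃ D : Set W, Dominates H D ∧ D.ncard = n}

/-- The secure domination number `γₛ(H)`. -/
noncomputable def secDomNum {W : Type*} (H : SimpleGraph W) : ℕ :=
  sInf {n | ∃ D : Set W, SecureDominates H D ∧ D.ncard = n}

/-- The edges of `G`, oriented from smaller to larger endpoint. -/
abbrev OEdge {V : Type*} (G : SimpleGraph V) [LinearOrder V] : Type _ :=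
  {p : V × V // G.Adj p.1 p.2 ∧ p.1 < p.2}

/-- The `k`-subdivision `G^{1/k}` (for `k ≥ 2`): each edge `uv` (with `u < v`) is replaced by the
path `u, x₁, …, x_{k-1}, v` of length `k`, the `x_i` being new internal vertices. -/
def Subdiv {V : Type*} (G : SimpleGraph V) [LinearOrder V] (k : ℕ) :
    SimpleGraph (V ⊕ (OEdge G × Fin (k - 1))) :=
  SimpleGraph.fromRel (fun a b =>
    match a, b with
    | Sum.inl u, Sum.inr ⟨e, i⟩ => (i.val = 0 ∧ u = e.val.1) ∨ (i.val = k - 2 ∧ u = e.val.2)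
    | Sum.inr ⟨e, i⟩, Sum.inr ⟨f, j⟩ => e = f ∧ i.val + 1 = j.val
    | _, _ => False)

/-- The star graph `K_{1,n-1}` on `Fin n`, with centre `0`. -/
def starGraph (n : ℕ) : SimpleGraph (Fin n) :=
  SimpleGraph.fromRel (fun a _ => a.val = 0)

/-- `G` is a star graph: some centre is adjacent to exactly the other vertices, and there
are no other edges. -/
def IsStar {V : Type*} (G : SimpleGraph V) : Prop :=
  ∃ c : V, ∀ u v : V, G.Adj u v ↔ (u ≠ v ∧ (u = c ∨ v = c))

lemma Dominates.map {V W : Type*} {G : SimpleGraph V} {H : SimpleGraph W} (φ : G ≃g H)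
    {D : Set V} (h : Dominates G D) : Dominates H (φ '' D) := by
  intro w hw
  obtain ⟨v, rfl⟩ := φ.surjective w
  have hv : v ∉ D := fun hv => hw ⟨v, hv, rfl⟩
  obtain ⟨u, hu, huv⟩ := h v hv
  exact ⟨φ u, ⟨u, hu, rfl⟩, φ.map_adj_iff.2 huv⟩

lemma SecureDominates.map {V W : Type*} {G : SimpleGraph V} {H : SimpleGraph W} (φ : G ≃g H)
    {D : Set V} (h : SecureDominates G D) : SecureDominates H (φ '' D) := by
  refine ⟨h.1.map φ, ?_⟩
  intro w hw
  obtain ⟨u, rfl⟩ := φ.surjective w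
  have hu : u ∉ D := fun hv => hw ⟨u, hv, rfl⟩
  obtain ⟨v, hv, huv, hd⟩ := h.2 u hu
  refine ⟨φ v, ⟨v, hv, rfl⟩, φ.map_adj_iff.2 huv, ?_⟩
  have := hd.map φ
  rwa [Set.image_union, Set.image_sdiff φ.injective, Set.image_singleton,
    Set.image_singleton] at this

lemma secDomNum_congr {V W : Type*} {G : SimpleGraph V} {H : SimpleGraph W} (φ : G ≃g H) :
    secDomNum G = secDomNum H := by
  unfold secDomNum
  congr 1
  ext n
  constructor
  · rintro ⟨D, hD, rfl⟩
    exact ⟨φ '' D, hD.map φ, Set.ncard_image_of_injective _ φ.injective⟩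
  · rintro ⟨D, hD, rfl⟩
    exact ⟨φ.symm '' D, hD.map φ.symm, Set.ncard_image_of_injective _ φ.symm.injective⟩

/-- Position on the path `P₂₁` of a vertex of the subdivision of `P₁₁`. -/
def pos : (Fin 11 ⊕ (OEdge (SimpleGraph.pathGraph 11) × Fin (2 - 1))) → Fin 21
  | Sum.inl u => ⟨2 * u.val, by omega⟩
  | Sum.inr ⟨e, _⟩ => ⟨2 * e.val.1.val + 1, by
      have h1 : e.val.1.val < e.val.2.val := e.2.2
      omega⟩

lemma oedge_succ (e : OEdge (SimpleGraph.pathGraph 11)) : e.val.2.val = e.val.1.val + 1 := by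
  have h1 : e.val.1.val < e.val.2.val := e.2.2
  have h2 := pathGraph_adj.1 e.2.1
  omega

lemma pos_bij : Function.Bijective pos := by
  constructor
  · rintro (u | ⟨e, i⟩) (v | ⟨f, j⟩) h
    · simp only [pos, Fin.mk.injEq] at h
      congr 1; ext; omega
    · simp only [pos, Fin.mk.injEq] at h
      omega
    · simp only [pos, Fin.mk.injEq] at h
      omega
    · simp only [pos, Fin.mk.injEq] at h
      have he := oedge_succ e
      have hf := oedge_succ f
      congr 2
      · apply Subtype.ext
        apply Prod.ext <;> ext <;> omega
      · exact Subsingleton.elim (α := Fin 1) i j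
  · intro w
    rcases Nat.even_or_odd' w.val with ⟨k, hk | hk⟩
    · refine ⟨Sum.inl ⟨k, by omega⟩, ?_⟩
      ext; simp [pos, hk]
    · refine ⟨Sum.inr ⟨⟨(⟨k, by omega⟩, ⟨k + 1, by omega⟩), ?_, ?_⟩, (0 : Fin 1)⟩, ?_⟩
      · rw [pathGraph_adj]; simp
      · simp
      · ext; simp [pos, hk]

noncomputable def posIso : Subdiv (SimpleGraph.pathGraph 11) 2 ≃g SimpleGraph.pathGraph 21 where
  toEquiv := Equiv.ofBijective pos pos_bij
  map_rel_iff' := by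
    rintro (u | ⟨e, i⟩) (v | ⟨f, j⟩)
    · simp [pathGraph_adj, pos, Subdiv]
      omega
    · have hf := oedge_succ f
      have hj := j.2
      simp [pathGraph_adj, pos, Subdiv, Fin.ext_iff]
      omega
    · have hf := oedge_succ e
      have hj := i.2
      simp [pathGraph_adj, pos, Subdiv, Fin.ext_iff]
      omega
    · have hi := i.2
      have hj := j.2
      simp [pathGraph_adj, pos, Subdiv]
      omega

/-- Local security condition at the middle of a window of seven vertices. -/
def localCond (a b c d e f g : Bool) : Bool := d || (c && (b || a)) || (e && (f || g))

/-- Exhaustive search with at most `k` further chosen vertices; `true` means no solution. -/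
def search : ℕ → ℕ → Bool → Bool → Bool → Bool → Bool → Bool → Bool
  | 0, _, a, b, c, d, e, f => !(localCond a b c d e f false && (e || (d && (c || b)) || f) &&
      (f || (e && (d || c))))
  | n + 1, k, a, b, c, d, e, f =>
      (!(localCond a b c d e f false) || search n k b c d e f false) &&
      (!(localCond a b c d e f true) || match k with
        | 0 => true
        | k + 1 => search n k b c d e f true)

lemma search_spec (x : ℕ → Bool) (n : ℕ) : ∀ (k i : ℕ),
    search n k (x i) (x (i+1)) (x (i+2)) (x (i+3)) (x (i+4)) (x (i+5)) = true →
    (∀ j < n, localCond (x (i+j)) (x (i+j+1)) (x (i+j+2)) (x (i+j+3)) (x (i+j+4)) (x (i+j+5))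
      (x (i+j+6)) = true) →
    (localCond (x (i+n)) (x (i+n+1)) (x (i+n+2)) (x (i+n+3)) (x (i+n+4)) (x (i+n+5)) false &&
      (x (i+n+4) || (x (i+n+3) && (x (i+n+2) || x (i+n+1))) || x (i+n+5)) &&
      (x (i+n+5) || (x (i+n+4) && (x (i+n+3) || x (i+n+2))))) = true →
    k < ∑ j ∈ Finset.range n, (x (i+6+j)).toNat := by
  induction n with
  | zero =>
    intro k i h _ h2
    simp only [search, Nat.add_zero] at h h2
    rw [h2] at h
    simp at h
  | succ n ih =>
    intro k i h h1 h2
    have h0 := h1 0 (by omega)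
    have step : ∀ k', search n k' (x (i+1)) (x (i+2)) (x (i+3)) (x (i+4)) (x (i+5))
        (x (i+6)) = true → k' < ∑ j ∈ Finset.range n, (x (i+1+6+j)).toNat := by
      intro k' hk
      apply ih k' (i+1) hk
      · intro j hj
        have := h1 (j+1) (by omega)
        rw [show i + (j+1) = i + 1 + j by omega] at this
        exact this
      · rw [show i + (n+1) = i + 1 + n by omega] at h2
        exact h2
    rw [Finset.sum_range_succ']
    have e : ∀ j, i + 6 + (j+1) = i+1+6+j := fun j => by omega
    simp only [e, Nat.add_zero] at h0 ⊢
    simp only [search, Bool.and_eq_true, Bool.or_eq_true] at h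
    cases hx : x (i+6) with
    | false =>
      rw [hx] at h0 step
      have := h.1
      rw [h0] at this
      simp at this
      have := step k this
      simpa using this
    | true =>
      rw [hx] at h0 step
      have := h.2
      rw [h0] at this
      cases k with
      | zero => simp
      | succ k =>
        simp at this
        have := step k this
        simpa using this

lemma search_start : ∀ a b c d e f : Bool,
    (a || (b && (c || d))) = true → (b || a || (c && (d || e))) = true →
    (c || (b && a) || (d && (e || f))) = true →
    search 15 (8 - (a.toNat + b.toNat + c.toNat + d.toNat + e.toNat + f.toNat))
      a b c d e f = true := by
  decide +kernel

lemma path_local {n : ℕ} {D : Set (Fin n)} (hD : SecureDominates (SimpleGraph.pathGraph n) D)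
    (x : ℕ → Prop) (hx : ∀ i, x i ↔ ∃ h : i < n, (⟨i, h⟩ : Fin n) ∈ D) (i : ℕ) (hi : i < n) :
    x i ∨ (∃ j, j + 1 = i ∧ x j ∧ ∀ k, k + 1 = j → (x k ∨ ∃ l, l + 1 = k ∧ x l)) ∨
      (x (i+1) ∧ (n ≤ i + 2 ∨ x (i+2) ∨ x (i+3))) := by
  by_cases h0 : (⟨i, hi⟩ : Fin n) ∈ D
  · exact Or.inl ((hx i).2 ⟨hi, h0⟩)
  right
  obtain ⟨v, hv, ha, hd⟩ := hD.2 _ h0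
  have key : ∀ k : Fin n, k.val ≠ v.val → k.val ≠ i → k.val ≠ i + 1 → k.val + 1 ≠ i →
      x k.val ∨ ∃ w : Fin n, w.val ≠ v.val ∧ x w.val ∧
        (w.val + 1 = k.val ∨ k.val + 1 = w.val) := by
    intro k h1 h2 h3 h4
    by_cases hk : k ∈ D
    · exact Or.inl ((hx _).2 ⟨k.2, hk⟩)
    right
    obtain ⟨w, hw, hwk⟩ := hd k (by
      rintro (h | h)
      · exact hk h.1
      · exact h2 (congrArg Fin.val h))
    rw [pathGraph_adj] at hwk
    rcases hw with hw | hw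
    · exact ⟨w, fun h => hw.2 (Fin.ext h), (hx _).2 ⟨w.2, hw.1⟩, hwk⟩
    · have : w.val = i := congrArg Fin.val hw
      omega
  have xv : x v.val := (hx _).2 ⟨v.2, hv⟩
  rw [pathGraph_adj] at ha
  simp only at ha
  rcases ha with ha | ha
  · right
    rw [ha]
    refine ⟨xv, ?_⟩
    by_cases hn : n ≤ i + 2
    · exact Or.inl hn
    right
    rcases key ⟨i + 2, by omega⟩ (by simp; omega) (by simp) (by simp) (by simp; omega) with h | h
    · exact Or.inl h
    · obtain ⟨w, h1, h2, h3⟩ := h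
      simp only at h3
      rw [show i + 3 = w.val by omega]
      exact Or.inr h2
  · left
    refine ⟨v.val, ha, xv, ?_⟩
    intro k hk
    rcases key ⟨k, by omega⟩ (by simp; omega) (by simp; omega) (by simp; omega)
      (by simp; omega) with h | h
    · exact Or.inl h
    · obtain ⟨w, h1, h2, h3⟩ := h
      simp only at h3
      exact Or.inr ⟨w.val, by omega, h2⟩

lemma path_lower {D : Set (Fin 21)} (hD : SecureDominates (SimpleGraph.pathGraph 21) D) :
    9 ≤ D.ncard := by
  classical
  let x : ℕ → Bool := fun i => decide (∃ h : i < 21, (⟨i, h⟩ : Fin 21) ∈ D)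
  have hx : ∀ i, x i = true ↔ ∃ h : i < 21, (⟨i, h⟩ : Fin 21) ∈ D := fun i => by simp [x]
  have hcard : D.ncard = ∑ i ∈ Finset.range 21, (x i).toNat := by
    rw [Finset.sum_range, Set.ncard_eq_toFinset_card', Finset.card_eq_sum_ones,
      ← Finset.sum_filter_add_sum_filter_not Finset.univ (fun i : Fin 21 => i ∈ D)]
    rw [Finset.sum_eq_zero (s := Finset.univ.filter (fun i : Fin 21 => ¬ i ∈ D))]
    · rw [Nat.add_zero]
      apply Finset.sum_congr
      · ext; simp
      · intro i hi
        have : i ∈ D := by simpa using hi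
        simp [x, this]
    · intro i hi
      have : i ∉ D := by simpa using hi
      simp [x, this]
  have loc := path_local hD (fun i => x i = true) hx
  have x21 : ∀ i, 21 ≤ i → x i = false := fun i hi => by
    simp [x]; omega
  clear_value x
  have mid : ∀ j < 15, localCond (x (0+j)) (x (0+j+1)) (x (0+j+2)) (x (0+j+3)) (x (0+j+4))
      (x (0+j+5)) (x (0+j+6)) = true := by
    intro j hj
    rw [Nat.zero_add]
    simp only [localCond, Bool.or_eq_true, Bool.and_eq_true]
    rcases loc (j+3) (by omega) with h | ⟨a, ha, h1, h2⟩ | ⟨h1, h2⟩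
    · simp [h]
    · obtain rfl : a = j + 2 := by omega
      rcases h2 (j+1) rfl with h | ⟨l, hl, h⟩
      · simp [h1, h]
      · obtain rfl : l = j := by omega
        simp [h1, h]
    · right
      refine ⟨h1, ?_⟩
      rcases h2 with h2 | h2
      · omega
      · exact h2
  have l0 := loc 0 (by omega)
  have l1 := loc 1 (by omega)
  have l2 := loc 2 (by omega)
  have l18 := loc 18 (by omega)
  have l19 := loc 19 (by omega)
  have l20 := loc 20 (by omega)
  simp [x21] at l0 l1 l2 l18 l19 l20
  have st := search_start (x 0) (x 1) (x 2) (x 3) (x 4) (x 5)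
    (by grind) (by grind) (by grind)
  have := search_spec x 15 _ 0 st mid (by
    simp only [localCond, Nat.zero_add, Nat.reduceAdd]
    grind)
  rw [hcard, Finset.sum_range_add (fun i => (x i).toNat) 6 15]
  simp only [Finset.sum_range_succ (n := 5), Finset.sum_range_succ (n := 4),
    Finset.sum_range_succ (n := 3), Finset.sum_range_succ (n := 2),
    Finset.sum_range_succ (n := 1), Finset.sum_range_succ (n := 0), Finset.sum_range_zero]
  simp only [Nat.zero_add] at this ⊢
  omega

lemma path_upper : ∃ D : Set (Fin 21), SecureDominates (SimpleGraph.pathGraph 21) D ∧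
    D.ncard = 9 := by
  refine ⟨(({1, 3, 5, 8, 10, 12, 15, 17, 19} : Finset (Fin 21)) : Set (Fin 21)), ?_, ?_⟩
  · simp only [SecureDominates, Dominates, pathGraph_adj, Set.mem_union, Set.mem_sdiff,
      Set.mem_singleton_iff, Finset.mem_coe]
    decide +kernel
  · rw [Set.ncard_coe_finset]; decide

lemma path_edges : Nat.card (SimpleGraph.pathGraph 11).edgeSet = 10 := by
  let f : Fin 10 → (SimpleGraph.pathGraph 11).edgeSet := fun i =>
    ⟨s(i.castSucc, i.succ), by simp [pathGraph_adj]⟩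
  have hf : Function.Bijective f := by
    constructor
    · intro i j h
      simp [f, Fin.ext_iff] at h
      ext; omega
    · rintro ⟨e, he⟩
      induction e with
      | _ a b =>
        rw [mem_edgeSet, pathGraph_adj] at he
        rcases he with h | h
        · refine ⟨⟨a.val, by omega⟩, ?_⟩
          simp [f, Fin.ext_iff]; omega
        · refine ⟨⟨b.val, by omega⟩, ?_⟩
          simp [f, Fin.ext_iff]; omega
  rw [← Nat.card_eq_of_bijective f hf]
  simp

/-- For the path `P₁₁`, `γₛ(P₁₁^{1/2}) = 9 < 10 = min {|E(P₁₁)|, |V(P₁₁)|}`. -/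
theorem stmt_15 :
    secDomNum (Subdiv (SimpleGraph.pathGraph 11) 2) = 9 ∧
    min (Nat.card (SimpleGraph.pathGraph 11).edgeSet) (Nat.card (Fin 11)) = 10 ∧
    (9 : ℕ) < 10 := by
  refine ⟨?_, ?_, by norm_num⟩
  · rw [secDomNum_congr posIso]
    apply le_antisymm
    · exact Nat.sInf_le path_upper
    · apply le_csInf ⟨9, path_upper⟩
      rintro n ⟨D, hD, rfl⟩
      exact path_lower hD
  · rw [path_edges]
    simp
end

section
/- For the 6-regular graph G on 7 vertices obtained from vertices u_1,...,u_7 with the edge set shown in the paper (the complement being a perfect structure making G have 12 edges), and more generally for the graph G of Figure 2 with 7 vertices and 12 edges, the secure domination number of G^{1/2} equals 7 = |V(G)|. -/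
open SimpleGraph

/-- The complete bipartite graph `K_{3,4}` on `Fin 7`. -/
def kGraph : SimpleGraph (Fin 7) where
  Adj a b := (a < 3 ∧ 3 ≤ b) ∨ (b < 3 ∧ 3 ≤ a)
  symm := ⟨fun _ _ h => h.symm⟩
  loopless := ⟨fun a h => by
    rcases h with h | h <;> exact absurd h.1 (not_lt.mpr h.2)⟩

instance : DecidableRel kGraph.Adj := fun a b =>
  inferInstanceAs (Decidable ((a < 3 ∧ 3 ≤ b) ∨ (b < 3 ∧ 3 ≤ a)))

lemma kGraph_card : Nat.card kGraph.edgeSet = 12 := by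
  rw [Nat.card_eq_fintype_card, ← SimpleGraph.edgeFinset_card]
  decide +kernel

lemma touch_card : ∀ U : Finset (Fin 7), 3 ≤ U.card →
    7 ≤ (Finset.univ.filter (fun p : Fin 7 × Fin 7 =>
      (kGraph.Adj p.1 p.2 ∧ p.1 < p.2) ∧ (p.1 ∈ U ∨ p.2 ∈ U))).card := by
  decide +kernel

section
variable {G : SimpleGraph (Fin 7)}

lemma sub_inl_inl (u v : Fin 7) : ¬ (Subdiv G 2).Adj (Sum.inl u) (Sum.inl v) := by
  simp [Subdiv]

lemma sub_inl_inr (u : Fin 7) (e : OEdge G) (i : Fin 1) :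
    (Subdiv G 2).Adj (Sum.inl u) (Sum.inr (e, i)) ↔ u = e.1.1 ∨ u = e.1.2 := by
  simp [Subdiv]

lemma sub_inr_inl (u : Fin 7) (e : OEdge G) (i : Fin 1) :
    (Subdiv G 2).Adj (Sum.inr (e, i)) (Sum.inl u) ↔ u = e.1.1 ∨ u = e.1.2 := by
  rw [SimpleGraph.adj_comm]; exact sub_inl_inr u e i

lemma sub_inr_inr (x y : OEdge G × Fin 1) :
    ¬ (Subdiv G 2).Adj (Sum.inr x) (Sum.inr y) := by
  obtain ⟨e, i⟩ := x
  obtain ⟨f, j⟩ := y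
  have : i = j := Subsingleton.elim _ _
  subst this
  simp [Subdiv]

/-- The set of all original vertices is secure dominating. -/
lemma secure_V : SecureDominates (Subdiv G 2) (Set.range Sum.inl) := by
  constructor
  · rintro (v | ⟨e, i⟩) hv
    · exact absurd ⟨v, rfl⟩ hv
    · exact ⟨Sum.inl e.1.1, ⟨_, rfl⟩, (sub_inl_inr _ e i).2 (Or.inl rfl)⟩
  · rintro (v | ⟨e, i⟩) hv
    · exact absurd ⟨v, rfl⟩ hv
    refine ⟨Sum.inl e.1.1, ⟨_, rfl⟩, (sub_inr_inl _ e i).2 (Or.inl rfl), ?_⟩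
    rintro (w | ⟨f, j⟩) hw
    · have hw' : w = e.1.1 := by
        by_contra hne
        exact hw (Or.inl ⟨⟨w, rfl⟩, fun h => hne (Sum.inl.inj h)⟩)
      exact ⟨Sum.inr (e, i), Or.inr rfl, (sub_inr_inl _ e i).2 (Or.inl hw')⟩
    · by_cases h : f.1.1 = e.1.1
      · refine ⟨Sum.inl f.1.2, Or.inl ⟨⟨_, rfl⟩, fun hh => ?_⟩, (sub_inl_inr _ f j).2 (Or.inr rfl)⟩
        have h2 : f.1.2 = e.1.1 := Sum.inl.inj hh
        have := f.2.2
        rw [h, h2] at this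
        exact lt_irrefl _ this
      · exact ⟨Sum.inl f.1.1, Or.inl ⟨⟨_, rfl⟩, fun hh => h (Sum.inl.inj hh)⟩,
          (sub_inl_inr _ f j).2 (Or.inl rfl)⟩

/-- A secure dominating set has at least as many elements as there are edges touching
original vertices outside of it. -/
lemma touch_le {D : Set (Fin 7 ⊕ (OEdge G × Fin 1))} (hD : SecureDominates (Subdiv G 2) D) :
    {e : OEdge G | Sum.inl e.1.1 ∉ D ∨ Sum.inl e.1.2 ∉ D}.ncard ≤ D.ncard := by
  classical
  have key : ∀ e : OEdge G, (Sum.inl e.1.1 ∉ D ∨ Sum.inl e.1.2 ∉ D) →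
      ∃ w ∈ D, (w = Sum.inr (e, 0)) ∨ (Sum.inr (e, 0) ∉ D ∧ ∃ x, w = Sum.inl x ∧
        (x = e.1.1 ∨ x = e.1.2) ∧
        Dominates (Subdiv G 2) ((D \ {Sum.inl x}) ∪ {Sum.inr (e, 0)})) := by
    intro e he
    by_cases h : Sum.inr (e, 0) ∈ D
    · exact ⟨_, h, Or.inl rfl⟩
    · obtain ⟨v, hv, hadj, hdom⟩ := hD.2 _ h
      rcases v with x | y
      · exact ⟨_, hv, Or.inr ⟨h, x, rfl, (sub_inr_inl _ _ _).1 hadj, hdom⟩⟩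
      · exact absurd hadj (sub_inr_inr _ _)
  choose! f hf hf2 using key
  refine Set.ncard_le_ncard_of_injOn f (fun e he => hf e he) ?_ (Set.toFinite _)
  intro e he e' he' hee
  rcases hf2 e he with h | ⟨hn, x, hx, hxe, hdom⟩
  · rcases hf2 e' he' with h' | ⟨hn', x', hx', -, -⟩
    · rw [h, h'] at hee
      exact (Prod.mk.inj (Sum.inr.inj hee)).1
    · rw [h, hx'] at hee
      cases hee
  · rcases hf2 e' he' with h' | ⟨hn', x', hx', hxe', -⟩
    · rw [hx, h'] at hee
      cases hee
    · have hxx : x = x' := by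
        rw [hx, hx'] at hee
        exact Sum.inl.inj hee
      subst hxx
      by_contra hne
      have hxD : Sum.inl x ∈ D := hx ▸ hf e he
      obtain ⟨w, hw, hadj⟩ := hdom (Sum.inr (e', 0)) (by
        rintro (h | h)
        · exact hn' h.1
        · exact hne (Prod.mk.inj (Sum.inr.inj h)).1.symm)
      rcases w with w | w
      · have hww := (sub_inl_inr _ _ _).1 hadj
        rcases hw with ⟨hwD, hwx⟩ | hw
        · have hwx' : w ≠ x := fun h => hwx (by rw [h]; rfl)
          rcases he' with he' | he' <;> rcases hww with rfl | rfl <;>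
            rcases hxe' with rfl | rfl <;> first | exact he' hwD | exact he' hxD | exact hwx' rfl
        · cases hw
      · exact sub_inr_inr _ _ hadj

end

lemma lower {D : Set (Fin 7 ⊕ (OEdge kGraph × Fin 1))}
    (hD : SecureDominates (Subdiv kGraph 2) D) : 7 ≤ D.ncard := by
  classical
  by_contra hlt
  push Not at hlt
  have hsplit : (Sum.inl ⁻¹' D).ncard + (Sum.inr ⁻¹' D).ncard = D.ncard := by
    rw [← Set.ncard_image_of_injective (Sum.inl ⁻¹' D) Sum.inl_injective,
      ← Set.ncard_image_of_injective (Sum.inr ⁻¹' D) Sum.inr_injective,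
      ← Set.ncard_union_eq _ (Set.toFinite _) (Set.toFinite _), Set.image_preimage_inl_union_image_preimage_inr]
    rw [Set.disjoint_left]
    rintro _ ⟨a, -, rfl⟩ ⟨b, -, h⟩
    cases h
  set U : Finset (Fin 7) := Finset.univ.filter (fun v => Sum.inl v ∉ D) with hU
  have hUA : U.card + (Sum.inl ⁻¹' D).ncard = 7 := by
    have h1 := Set.ncard_add_ncard_compl (Sum.inl ⁻¹' D : Set (Fin 7))
    have h2 : (Sum.inl ⁻¹' D : Set (Fin 7))ᶜ = (U : Set (Fin 7)) := by
      ext v; simp [hU]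
    rw [h2, Set.ncard_coe_finset] at h1
    simp at h1
    omega
  have hU2 : U.card ≤ 2 := by
    by_contra h3
    have h7 := touch_card U (by omega)
    have hle := touch_le hD
    rw [← Set.ncard_image_of_injective _ Subtype.val_injective] at hle
    have heq : (Subtype.val '' {e : OEdge kGraph | Sum.inl e.1.1 ∉ D ∨ Sum.inl e.1.2 ∉ D}) =
        ((Finset.univ.filter (fun p : Fin 7 × Fin 7 =>
          (kGraph.Adj p.1 p.2 ∧ p.1 < p.2) ∧ (p.1 ∈ U ∨ p.2 ∈ U)) : Finset _) :
            Set (Fin 7 × Fin 7)) := by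
      ext p
      simp [hU]
      exact and_comm
    rw [heq, Set.ncard_coe_finset] at hle
    omega
  have hUpos : 0 < U.card := by omega
  obtain ⟨u, hu⟩ := Finset.card_pos.1 hUpos
  have huD : Sum.inl u ∉ D := by simpa [hU] using hu
  obtain ⟨v, hv, hadj, hdom⟩ := hD.2 _ huD
  rcases v with v | e
  · exact sub_inl_inl _ _ hadj
  have hBpos : 0 < (Sum.inr ⁻¹' D).ncard := (Set.ncard_pos (Set.toFinite _)).2 ⟨e, hv⟩
  have hB1 : (Sum.inr ⁻¹' D).ncard = 1 := by omega
  obtain ⟨b, hb⟩ := Set.ncard_eq_one.1 hB1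
  have hbe : ∀ x, Sum.inr x ∈ D → x = e := by
    intro x hx
    have h1 : x ∈ (Sum.inr ⁻¹' D) := hx
    have h2 : e ∈ (Sum.inr ⁻¹' D) := hv
    rw [hb] at h1 h2
    exact h1.trans h2.symm
  obtain ⟨u', hu', hne⟩ := Finset.exists_mem_ne (by omega : 1 < U.card) u
  have hu'D : Sum.inl u' ∉ D := by simpa [hU] using hu'
  obtain ⟨w, hw, hadj'⟩ := hdom (Sum.inl u') (by
    rintro (h | h)
    · exact hu'D h.1
    · exact hne (Sum.inl.inj h))
  rcases w with w | w
  · exact sub_inl_inl _ _ hadj'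
  · rcases hw with ⟨h1, h2⟩ | h
    · exact h2 (by rw [hbe w h1]; rfl)
    · cases h

/-- There is a graph `G` on `7` vertices with `12` edges (the graph of Figure 2)
such that `γₛ(G^{1/2}) = 7 = |V(G)| < |E(G)|`, so the bound `|V(G)|` in
`γₛ(G^{1/2}) ≤ min {|E(G)|, |V(G)|}` can be the attained minimum. -/
theorem stmt_18 :
    ∃ G : SimpleGraph (Fin 7),
      Nat.card G.edgeSet = 12 ∧ secDomNum (Subdiv G 2) = 7 := by
  refine ⟨kGraph, kGraph_card, le_antisymm ?_ ?_⟩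
  · refine Nat.sInf_le ⟨Set.range Sum.inl, secure_V, ?_⟩
    rw [← Set.image_univ, Set.ncard_image_of_injective _ Sum.inl_injective]
    simp
  · refine le_csInf ⟨_, _, secure_V, rfl⟩ ?_
    rintro n ⟨D, hD, rfl⟩
    exact lower hD
end
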